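/- arXiv:1202.2451 — 2 statements merged into one kernel-verified Lean document; each statement's English description precedes it below -/
import Mathlib

section
/- Let K be a field and A a subring of K. For every subset S of K, the set B_S := {V ∈ Zar(K|A) : S ⊆ V} is stable for ultrafilters, i.e., B_S is closed in the ultrafilter topology. In particular, each basic Zariski-open set B_F (F finite ⊆ K) is both open and closed in the ultrafilter topology. -/
open TopologicalSpace

variable {K : Type*} [Field K]

/-- `Zar A` is the Zariski–Riemann space `Zar(K|A)`: the valuation subrings of `K` containing `A`. -/
abbrev Zar (A : Subring K) : Type _ := {V : ValuationSubring K // A ≤ V.toSubring}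

/-- `bo A S` is the set `B_S = {V ∈ Zar(K|A) : S ⊆ V}`. -/
def bo (A : Subring K) (S : Set K) : Set (Zar A) := {V | S ⊆ (V.1 : Set K)}

/-- For an ultrafilter `U` on a subset `Y` of `Zar(K|A)`, the set
`A_U = {x ∈ K : B_x ∩ Y ∈ U}`. -/
def ultraSet (A : Subring K) {Y : Set (Zar A)} (U : Ultrafilter Y) : Set K :=
  {x | {V : Y | x ∈ V.1.1} ∈ U}

/-- A subset `Y` of `Zar(K|A)` is stable for ultrafilters if `A_U ∈ Y` for every
ultrafilter `U` on `Y`. -/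
def UltraStable (A : Subring K) (Y : Set (Zar A)) : Prop :=
  ∀ (U : Ultrafilter Y) (W : Zar A), (W.1 : Set K) = ultraSet A U → W ∈ Y

/-- The Zariski topology on `Zar(K|A)`, with the sets `B_F` (`F ⊆ K` finite) as a basis. -/
def zarTop (A : Subring K) : TopologicalSpace (Zar A) :=
  generateFrom {S | ∃ F : Finset K, S = bo A ↑F}

/-- The `#`-topology on `Zar(K|A)`: the coarsest topology in which every `B_F`
(`F ⊆ K` finite) is both open and closed. -/
def sharpTop (A : Subring K) : TopologicalSpace (Zar A) :=
  generateFrom ({S | ∃ F : Finset K, S = bo A ↑F} ∪ {S | ∃ F : Finset K, S = (bo A ↑F)ᶜ})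

/-- The Boolean algebra of sets generated by a family `G` of subsets of `X`. -/
inductive BoolGen {X : Type*} (G : Set (Set X)) : Set X → Prop
  | base (s : Set X) (hs : s ∈ G) : BoolGen G s
  | compl (s : Set X) (hs : BoolGen G s) : BoolGen G sᶜ
  | union (s t : Set X) (hs : BoolGen G s) (ht : BoolGen G t) : BoolGen G (s ∪ t)
  | inter (s t : Set X) (hs : BoolGen G s) (ht : BoolGen G t) : BoolGen G (s ∩ t)

/-- The constructible topology associated with a topology `t` on `X`: the topology having as a
basis of open sets the Boolean algebra generated by the quasi-compact open subsets of `(X, t)`. -/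
def consTop {X : Type*} (t : TopologicalSpace X) : TopologicalSpace X :=
  generateFrom {s | BoolGen {U : Set X | t.IsOpen U ∧ @IsCompact X t U} s}

/-- The center map `γ : Zar(K|A) → Spec(A)` sending `V` to `M_V ∩ A`. -/
noncomputable def centerMap (A : Subring K) (V : Zar A) : PrimeSpectrum ↥A :=
  ⟨(IsLocalRing.maximalIdeal ↥V.1).comap (Subring.inclusion V.2), inferInstance⟩

/-- `x` belongs to the maximal ideal `M_V` of the valuation subring `V`. -/
def inMax (V : ValuationSubring K) (x : K) : Prop :=
  ∃ h : x ∈ V, (⟨x, h⟩ : ↥V) ∈ IsLocalRing.maximalIdeal ↥V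

/-- The constructible (patch) topology on `Spec R`: the coarsest topology in which every basic
open set `D_a = {P : a ∉ P}` is both open and closed. -/
def patchTop (R : Type*) [CommRing R] : TopologicalSpace (PrimeSpectrum R) :=
  generateFrom ({S | ∃ a : R, S = {P : PrimeSpectrum R | a ∉ P.asIdeal}} ∪
    {S | ∃ a : R, S = {P : PrimeSpectrum R | a ∉ P.asIdeal}ᶜ})

/-- The ultrafilter limit point set `P_U = {a ∈ R : V(a) ∩ C ∈ U}`. -/
def specLimitSet {R : Type*} [CommRing R] {C : Set (PrimeSpectrum R)} (U : Ultrafilter C) :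
    Set R :=
  {a | {P : C | a ∈ P.1.asIdeal} ∈ U}

/-- A subset `C ⊆ Spec R` is ultrafilter closed if it contains all of its ultrafilter limit
points. -/
def SpecStable {R : Type*} [CommRing R] (C : Set (PrimeSpectrum R)) : Prop :=
  ∀ (U : Ultrafilter C) (P : PrimeSpectrum R), (P.asIdeal : Set R) = specLimitSet U → P ∈ C

theorem ultraStable_bo {K : Type*} [Field K] (A : Subring K) (S : Set K) :
    UltraStable A (bo A S) := by
  intro U W hW x hx
  rw [hW]
  exact Filter.mem_of_superset Filter.univ_mem fun V _ => V.2 hx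

theorem ultraStable_compl_bo {K : Type*} [Field K] (A : Subring K) (F : Finset K) :
    UltraStable A (bo A (F : Set K))ᶜ := by
  intro U W hW hF
  have h : (⋂ x ∈ F, {V : ((bo A (F : Set K))ᶜ : Set (Zar A)) | x ∈ V.1.1}) ∈ U :=
    (Filter.biInter_finset_mem F).2 fun x hx => by
      have hxW : x ∈ (W.1 : Set K) := hF hx
      rwa [hW] at hxW
  obtain ⟨V, hV⟩ := U.nonempty_of_mem h
  exact V.2 fun x hx => Set.mem_iInter₂.1 hV x hx

/-- For every subset `S` of `K`, the set `B_S` is stable for ultrafilters (i.e.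
closed in the ultrafilter topology); in particular each basic Zariski-open set `B_F` (`F ⊆ K`
finite) is both open and closed in the ultrafilter topology. -/
theorem statement4 {K : Type*} [Field K] (A : Subring K)
    (t : TopologicalSpace (Zar A)) (ht : ∀ C : Set (Zar A), @IsClosed _ t C ↔ UltraStable A C) :
    (∀ S : Set K, UltraStable A (bo A S)) ∧
      ∀ F : Finset K, @IsOpen _ t (bo A ↑F) ∧ @IsClosed _ t (bo A ↑F) := by
  exact ⟨ultraStable_bo A, fun F =>
    ⟨(@isClosed_compl_iff _ t _).1 ((ht _).2 (ultraStable_compl_bo A F)),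
      (ht _).2 (ultraStable_bo A F)⟩⟩
end

section
/- Let K be a field and A a subring of K. The ultrafilter topology on Zar(K|A) is compact and Hausdorff; in particular, every collection of subsets of Zar(K|A) stable for ultrafilters which has the finite intersection property has nonempty intersection. -/
open TopologicalSpace

variable {K : Type*} [Field K]

/-- The valuation ring `A_F = {x : B_x ∈ F}` attached to an ultrafilter `F` on `Zar(K|A)`. -/
def ultraLimit (A : Subring K) (F : Ultrafilter (Zar A)) : Zar A where
  val :=
    { carrier := {x | {V : Zar A | x ∈ V.1} ∈ F}
      zero_mem' := Filter.Eventually.of_forall fun V => V.1.zero_mem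
      one_mem' := Filter.Eventually.of_forall fun V => V.1.one_mem
      add_mem' := fun {x y} hx hy => by
        filter_upwards [hx, hy] with V h₁ h₂ using V.1.add_mem x y h₁ h₂
      mul_mem' := fun {x y} hx hy => by
        filter_upwards [hx, hy] with V h₁ h₂ using V.1.mul_mem x y h₁ h₂
      neg_mem' := fun {x} hx => by
        filter_upwards [hx] with V h using V.1.neg_mem x h
      mem_or_inv_mem' := fun x => Ultrafilter.eventually_or.1
        (Filter.Eventually.of_forall fun V => V.1.mem_or_inv_mem x) }
  property := fun _ hx => Filter.Eventually.of_forall fun V => V.2 hx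

theorem ultraStable_iff {A : Subring K} {C : Set (Zar A)} :
    UltraStable A C ↔ ∀ F : Ultrafilter (Zar A), C ∈ F → ultraLimit A F ∈ C := by
  constructor
  · intro h F hF
    have hr : Set.range (Subtype.val : C → Zar A) ∈ F := by rwa [Subtype.range_coe]
    refine h (F.comap Subtype.val_injective hr) _ (Set.ext fun x => ?_)
    change {V : Zar A | x ∈ V.1} ∈ (F : Filter (Zar A)) ↔
      {V : Zar A | x ∈ V.1} ∈ ((F : Filter (Zar A)).comap (Subtype.val : C → Zar A)).map Subtype.val
    rw [Filter.map_comap_of_mem hr]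
  · intro h U W hW
    have hW' : W = ultraLimit A (U.map Subtype.val) :=
      Subtype.ext (SetLike.coe_injective hW)
    rw [hW']
    exact h _ (Ultrafilter.mem_map.2 (Filter.univ_mem' Subtype.property))

theorem ultraStable_setOf_mem (A : Subring K) (x : K) :
    UltraStable A {V : Zar A | x ∈ V.1} :=
  ultraStable_iff.2 fun _ => id

theorem ultraStable_compl_setOf_mem (A : Subring K) (x : K) :
    UltraStable A {V : Zar A | x ∈ V.1}ᶜ :=
  ultraStable_iff.2 fun _ => Ultrafilter.compl_mem_iff_notMem.1

/-- The ultrafilter topology on `Zar(K|A)` is compact and Hausdorff; in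
particular, every collection of subsets stable for ultrafilters with the finite intersection
property has nonempty intersection. -/
theorem statement7 {K : Type*} [Field K] (A : Subring K)
    (t : TopologicalSpace (Zar A)) (ht : ∀ C : Set (Zar A), @IsClosed _ t C ↔ UltraStable A C) :
    (@CompactSpace (Zar A) t ∧ @T2Space (Zar A) t) ∧
      ∀ 𝒞 : Set (Set (Zar A)), (∀ C ∈ 𝒞, UltraStable A C) →
        (∀ 𝒢 : Set (Set (Zar A)), 𝒢 ⊆ 𝒞 → 𝒢.Finite → (⋂₀ 𝒢).Nonempty) →
          (⋂₀ 𝒞).Nonempty := by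
  refine ⟨⟨⟨?_⟩, ⟨?_⟩⟩, ?_⟩
  · refine isCompact_iff_ultrafilter_le_nhds.2 fun F _ => ⟨ultraLimit A F, trivial, ?_⟩
    refine le_nhds_iff.2 fun s hs hso => ?_
    by_contra hsF
    exact ultraStable_iff.1 ((ht _).1 hso.isClosed_compl) F
      (Ultrafilter.compl_mem_iff_notMem.2 hsF) hs
  · have hopen (x : K) : IsOpen {V : Zar A | x ∈ V.1} :=
      isClosed_compl_iff.1 ((ht _).2 (ultraStable_compl_setOf_mem A x))
    have hopen' (x : K) : IsOpen {V : Zar A | x ∈ V.1}ᶜ :=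
      ((ht _).2 (ultraStable_setOf_mem A x)).isOpen_compl
    intro V W hVW
    obtain ⟨x, hx⟩ : ∃ x, ¬(x ∈ V.1 ↔ x ∈ W.1) := by
      by_contra! h
      exact hVW (Subtype.ext (SetLike.ext h))
    by_cases hV : x ∈ V.1
    · exact ⟨_, _, hopen x, hopen' x, hV, fun hW => hx (iff_of_true hV hW), disjoint_compl_right⟩
    · exact ⟨_, _, hopen' x, hopen x, hV, by_contra fun hW => hx (iff_of_false hV hW),
        disjoint_compl_left⟩
  · intro 𝒞 hst hfip
    have : (Filter.generate 𝒞).NeBot := Filter.generate_neBot_iff.2 hfip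
    exact ⟨ultraLimit A (Ultrafilter.of (Filter.generate 𝒞)), fun C hC =>
      ultraStable_iff.1 (hst C hC) _
        (Ultrafilter.of_le _ (Filter.mem_generate_of_mem hC))⟩
end
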